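/- arXiv:2210.14351 — 3 statements merged into one kernel-verified Lean document; each statement's English description precedes it below -/
import Mathlib

section
/- For every y ∈ ℝ, the partition function of the LINEX loss is the constant ∫_ℝ exp(−(exp(x − y) − (x − y) − 1)) dx = e, independent of y. -/
open MeasureTheory Real

/-- The partition function of the LINEX loss `x ↦ exp (x - y) - (x - y) - 1` is the
constant `e = exp 1`, independent of `y`. -/
theorem stmt_6 (y : ℝ) :
    (∫ x : ℝ, Real.exp (-(Real.exp (x - y) - (x - y) - 1))) = Real.exp 1 := by
  rw [integral_sub_right_eq_self (fun x : ℝ => Real.exp (-(Real.exp x - x - 1))) y]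
  have h := integral_image_eq_integral_abs_deriv_smul (s := Set.univ) MeasurableSet.univ
    (fun x _ => (Real.hasDerivAt_exp x).hasDerivWithinAt) Real.exp_injective.injOn
    (fun t : ℝ => Real.exp (-t))
  rw [Set.image_univ, Real.range_exp, integral_exp_neg_Ioi_zero, setIntegral_univ] at h
  have h2 : (fun x : ℝ => Real.exp (-(Real.exp x - x - 1)))
      = fun x => Real.exp 1 * (|Real.exp x| • Real.exp (-Real.exp x)) := by
    funext x
    rw [abs_of_pos (Real.exp_pos x), smul_eq_mul, ← Real.exp_add, ← Real.exp_add]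
    congr 1
    ring
  rw [h2, integral_const_mul, ← h, mul_one]
end

section
/- Define the sequence x₀ = 1 and x_{n+1} = 2 + exp(x_n − 1) (the fixed-point iteration obtained by alternately updating the arc travel time x to the value 1 + 1/p(x) that matches the observed travel time 2). Then the sequence (x_n) is strictly increasing and tends to infinity; i.e., minimizing the loss of the expected travel time by this iterative scheme diverges. -/
open Real Filter

/-- The fixed-point iteration `x₀ = 1`, `x_{n+1} = 2 + exp (x_n - 1)` (alternately
matching the observed travel time 2 in the two-arc network) is strictly increasing
and diverges to infinity. -/
theorem stmt_10 (x : ℕ → ℝ) (h0 : x 0 = 1)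
    (hrec : ∀ n : ℕ, x (n + 1) = 2 + Real.exp (x n - 1)) :
    StrictMono x ∧ Tendsto x atTop atTop := by
  have step : ∀ n : ℕ, x n + 2 ≤ x (n + 1) := by
    intro n
    have h := Real.add_one_le_exp (x n - 1)
    rw [hrec n]
    linarith
  refine ⟨strictMono_nat_of_lt_succ fun n => by linarith [step n], ?_⟩
  have lower : ∀ n : ℕ, (n : ℝ) ≤ x n := by
    intro n
    induction n with
    | zero => rw [h0]; norm_num
    | succ k ih =>
      push_cast
      linarith [step k]
  exact tendsto_atTop_mono lower tendsto_natCast_atTop_atTop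
end

section
/- Let p(x) = exp(−x)/(exp(−x) + exp(−1)) and define the expected loss L(x) = p(x) · (log x − log 2)² + (1 − p(x)) · (log 2)² for x > 0. Then the derivative of L at x = 2 is nonzero, and consequently x = 2 is not a minimizer of L on (0, ∞): there exists x > 0 with L(x) < L(2). -/
open Real

/-- With `p(x) = exp (-x) / (exp (-x) + exp (-1))` and expected loss
`L(x) = p(x) (log x - log 2)² + (1 - p(x)) (log 2)²`, the derivative of `L` at `x = 2`
is nonzero, and `x = 2` is not a minimizer of `L` on `(0, ∞)`. -/
theorem stmt_11 :
    deriv (fun x : ℝ =>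
        (Real.exp (-x) / (Real.exp (-x) + Real.exp (-1))) * (Real.log x - Real.log 2) ^ 2 +
          (1 - Real.exp (-x) / (Real.exp (-x) + Real.exp (-1))) * (Real.log 2) ^ 2) 2 ≠ 0 ∧
    ∃ x : ℝ, 0 < x ∧
      (Real.exp (-x) / (Real.exp (-x) + Real.exp (-1))) * (Real.log x - Real.log 2) ^ 2 +
          (1 - Real.exp (-x) / (Real.exp (-x) + Real.exp (-1))) * (Real.log 2) ^ 2 <
        (Real.exp (-(2 : ℝ)) / (Real.exp (-(2 : ℝ)) + Real.exp (-1))) *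
            (Real.log 2 - Real.log 2) ^ 2 +
          (1 - Real.exp (-(2 : ℝ)) / (Real.exp (-(2 : ℝ)) + Real.exp (-1))) *
            (Real.log 2) ^ 2 := by
  have hS : Real.exp (-(2:ℝ)) + Real.exp (-1) ≠ 0 := by positivity
  have hE : HasDerivAt (fun x : ℝ => Real.exp (-x)) (Real.exp (-(2:ℝ)) * (-1)) 2 :=
    (hasDerivAt_neg (2:ℝ)).exp
  have hp := hE.div (hE.add_const (Real.exp (-1))) hS
  have hl := ((Real.hasDerivAt_log (two_ne_zero : (2:ℝ) ≠ 0)).sub_const (Real.log 2)).pow 2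
  have hL := (hp.mul hl).add ((hp.const_sub 1).mul_const ((Real.log 2) ^ 2))
  have hne : deriv (fun x : ℝ =>
        (Real.exp (-x) / (Real.exp (-x) + Real.exp (-1))) * (Real.log x - Real.log 2) ^ 2 +
          (1 - Real.exp (-x) / (Real.exp (-x) + Real.exp (-1))) * (Real.log 2) ^ 2) 2 ≠ 0 := by
    have h2 : 0 < Real.log 2 := Real.log_pos (by norm_num)
    have key : (0:ℝ) < Real.exp (-2) * Real.exp (-1) / (Real.exp (-2) + Real.exp (-1)) ^ 2
        * (Real.log 2) ^ 2 := by positivity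
    have e := hL.deriv
    refine ne_of_gt (lt_of_lt_of_eq key (Eq.trans ?_ e.symm))
    simp
    ring
  refine ⟨hne, ?_⟩
  by_contra! hcon
  apply hne
  apply IsLocalMin.deriv_eq_zero
  filter_upwards [lt_mem_nhds (show (0:ℝ) < 2 by norm_num)] with x hx
  exact hcon x hx
end
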